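/- (Corollary: irreducible sectors of the p-form symmetry.) For every cocycle φ ∈ Z^p(G) and every chain k ∈ C_p(Ĝ), the operator Q_k = Σ_{k' ∈ C_p(Ĝ), k' − k ∈ B_p(Ĝ)} P(k') satisfies U(φ) Q_k = e^{i⟨k,φ⟩} Q_k. -/

import Mathlib

open Finset

set_option linter.unusedSectionVars false

noncomputable section

/-- The Pontryagin dual `Ĝ = Hom(G, ℝ/2πℤ)` of an abelian group `G`,
where `ℝ/2πℤ` is `Real.Angle = AddCircle (2π)`. -/
abbrev PDual (G : Type) [AddCommGroup G] : Type := G →+ Real.Angle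

/-- The dual of a finite abelian group is finite (hence all the `∑ᶠ` sums over
(subsets of) chain groups with coefficients in `PDual G` below are honest
finite sums). -/
instance PDual.finite (G : Type) [AddCommGroup G] [Fintype G] : Finite (PDual G) := by
  classical
  set n := Fintype.card G with hn
  have hn0 : 0 < n := Fintype.card_pos
  haveI : Fact (0 < 2 * Real.pi) := ⟨by positivity⟩
  have hT0 : Set.Finite {θ : AddCircle (2 * Real.pi) | n • θ = 0} := by
    have hU : Set.Finite
        (⋃ d ∈ Finset.Icc 1 n, {θ : AddCircle (2 * Real.pi) | addOrderOf θ = d}) :=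
      Set.Finite.biUnion (Finset.Icc 1 n).finite_toSet
        (fun d hd => AddCircle.finite_setOf_addOrderOf_eq (2 * Real.pi)
          (by simp only [Finset.coe_Icc, Set.mem_Icc] at hd; exact hd.1))
    refine hU.subset ?_
    intro θ hθ
    have hfin : IsOfFinAddOrder θ := by
      rw [isOfFinAddOrder_iff_nsmul_eq_zero]
      exact ⟨n, hn0, hθ⟩
    have hdvd : addOrderOf θ ∣ n := addOrderOf_dvd_of_nsmul_eq_zero hθ
    have hpos : 0 < addOrderOf θ := hfin.addOrderOf_pos
    refine Set.mem_iUnion₂.mpr ⟨addOrderOf θ, ?_, rfl⟩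
    simp only [Finset.mem_Icc]
    exact ⟨hpos, Nat.le_of_dvd hn0 hdvd⟩
  have hT : Set.Finite {θ : Real.Angle | n • θ = 0} := hT0
  haveI : Finite {θ : Real.Angle | n • θ = 0} := hT.to_subtype
  have hinj : Function.Injective
      (fun (k : G →+ Real.Angle) (g : G) =>
        (⟨k g, by
          show n • k g = 0
          rw [← map_nsmul, card_nsmul_eq_zero, map_zero]⟩ :
          {θ : Real.Angle | n • θ = 0})) := by
    intro k₁ k₂ h
    ext g
    have := congrFun h g
    simpa [Subtype.ext_iff] using this
  exact Finite.of_injective _ hinj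

/-- The well-defined complex exponential `e^{iθ} = cos θ + i sin θ` for `θ ∈ ℝ/2πℤ`. -/
def expA (θ : Real.Angle) : ℂ := Real.Angle.cos θ + Real.Angle.sin θ * Complex.I

variable {G : Type} [AddCommGroup G] [Fintype G]

/-- The pairing `⟨k, φ⟩ = ∑_{σ ∈ Δ} k(σ)(φ(σ))` with values in `ℝ/2πℤ`. -/
def pairing {Δ : Type} [Fintype Δ] (k : Δ → PDual G) (φ : Δ → G) : Real.Angle :=
  ∑ σ, k σ (φ σ)

/-- The boundary map `∂`, `(∂k')(σ) = ∑_τ s(τ,σ) • k'(τ)`; its image is the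
boundary group `B_p(Ĝ)` and its kernel the cycle group `Z_{p+1}(Ĝ)`. -/
def bd {A B : Type} [Fintype A] (s : A → B → ℤ) (k' : A → PDual G) : B → PDual G :=
  fun σ => ∑ τ, s τ σ • k' τ

/-- The coboundary map `δ`, `(δφ)(τ) = ∑_σ s(τ,σ) • φ(σ)`; its kernel is the
cocycle group `Z^p(G)` and its image the coboundary group `B^{p+1}(G)`. -/
def cb {A B : Type} [Fintype B] (s : A → B → ℤ) (φ : B → G) : A → G :=
  fun τ => ∑ σ, s τ σ • φ σ

variable {H : Type} [NormedAddCommGroup H] [InnerProductSpace ℂ H]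
  [FiniteDimensional ℂ H]

/-- The product of a pairwise-commuting finite family of operators. -/
def commProd {ι : Type} [Fintype ι] (f : ι → H →L[ℂ] H)
    (h : ∀ i j, Commute (f i) (f j)) : H →L[ℂ] H :=
  Finset.univ.noncommProd f (fun a _ b _ _ => h a b)

variable {Δp Δp1 : Type} [Fintype Δp] [Fintype Δp1]

/-- `U(φ) = ∏_{σ ∈ Δ^p} U_σ(φ(σ))`. -/
def Uop (U : Δp → G → H →L[ℂ] H)
    (hU : ∀ σ σ' g g', Commute (U σ g) (U σ' g')) (φ : Δp → G) : H →L[ℂ] H :=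
  commProd (fun σ => U σ (φ σ)) fun σ σ' => hU σ σ' _ _

/-- The local factor `|G|⁻¹ ∑_{g ∈ G} e^{−i k(σ)(g)} U_σ(g)` of `P(k)`. -/
def Pfactor (U : Δp → G → H →L[ℂ] H) (k : Δp → PDual G) (σ : Δp) : H →L[ℂ] H :=
  (Fintype.card G : ℂ)⁻¹ • ∑ g : G, expA (-(k σ g)) • U σ g

theorem Pfactor_commute (U : Δp → G → H →L[ℂ] H)
    (hU : ∀ σ σ' g g', Commute (U σ g) (U σ' g')) (k : Δp → PDual G)
    (σ σ' : Δp) : Commute (Pfactor U k σ) (Pfactor U k σ') := by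
  unfold Pfactor
  apply Commute.smul_left
  apply Commute.smul_right
  apply Commute.sum_left
  intro g _
  apply Commute.sum_right
  intro g' _
  exact ((hU σ σ' g g').smul_right _).smul_left _

/-- The projector `P(k) = ∏_{σ ∈ Δ^p} ( |G|⁻¹ ∑_{g ∈ G} e^{−i k(σ)(g)} U_σ(g) )`. -/
def Pop (U : Δp → G → H →L[ℂ] H)
    (hU : ∀ σ σ' g g', Commute (U σ g) (U σ' g')) (k : Δp → PDual G) : H →L[ℂ] H :=
  commProd (Pfactor U k) (Pfactor_commute U hU k)

/-- `Ũ(k') = ∏_{τ ∈ Δ^{p+1}} Ũ_τ(k'(τ))`. -/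
def Utop (Ut : Δp1 → PDual G → H →L[ℂ] H)
    (hUt : ∀ τ τ' ρ ρ', Commute (Ut τ ρ) (Ut τ' ρ')) (k' : Δp1 → PDual G) : H →L[ℂ] H :=
  commProd (fun τ => Ut τ (k' τ)) fun τ τ' => hUt τ τ' _ _

/-- The minimal coupling operator `𝒰 = ∑_{k ∈ B_p(Ĝ)} P(k) Ũ(r(k))`, for a fixed
section `r` of the boundary map. -/
def MC (s : Δp1 → Δp → ℤ) (U : Δp → G → H →L[ℂ] H)
    (hU : ∀ σ σ' g g', Commute (U σ g) (U σ' g'))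
    (Ut : Δp1 → PDual G → H →L[ℂ] H)
    (hUt : ∀ τ τ' ρ ρ', Commute (Ut τ ρ) (Ut τ' ρ'))
    (r : (Δp → PDual G) → (Δp1 → PDual G)) : H →L[ℂ] H :=
  ∑ᶠ k ∈ Set.range (bd (G := G) s), Pop U hU k * Utop Ut hUt (r k)

theorem expA_zero : expA 0 = 1 := by simp [expA]

theorem expA_add (a b : Real.Angle) : expA (a + b) = expA a * expA b := by
  simp only [expA, Real.Angle.cos_add, Real.Angle.sin_add]
  push_cast
  linear_combination (-(a.sin : ℂ) * (b.sin : ℂ)) * Complex.I_mul_I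

theorem expA_sum {ι : Type} (t : Finset ι) (f : ι → Real.Angle) :
    expA (∑ i ∈ t, f i) = ∏ i ∈ t, expA (f i) := by
  classical
  induction t using Finset.induction_on with
  | empty => simp [expA_zero]
  | insert a t ha ih => rw [Finset.sum_insert ha, Finset.prod_insert ha, expA_add, ih]

theorem U_mul_Pfactor (U : Δp → G → H →L[ℂ] H)
    (hUhom : ∀ σ g g', U σ (g + g') = U σ g * U σ g')
    (k : Δp → PDual G) (σ : Δp) (x : G) :
    U σ x * Pfactor U k σ = expA (k σ x) • Pfactor U k σ := by
  unfold Pfactor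
  rw [mul_smul_comm, smul_comm (expA _)]
  congr 1
  rw [Finset.mul_sum, Finset.smul_sum]
  refine Fintype.sum_equiv (Equiv.addLeft x) _ _ fun g => ?_
  rw [Equiv.coe_addLeft, mul_smul_comm, smul_smul, ← expA_add, hUhom, map_add]
  congr 2
  abel

theorem noncommProd_mul_eq_smul {ι : Type} (t : Finset ι) (u f : ι → H →L[ℂ] H) (c : ι → ℂ)
    (huf : ∀ i, u i * f i = c i • f i) (hc : ∀ i j, Commute (u i) (f j))
    (hu : (t : Set ι).Pairwise (Function.onFun Commute u))
    (hf : (t : Set ι).Pairwise (Function.onFun Commute f)) :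
    t.noncommProd u hu * t.noncommProd f hf = (∏ i ∈ t, c i) • t.noncommProd f hf := by
  classical
  induction t using Finset.induction_on with
  | empty => simp
  | insert a t ha ih =>
    rw [Finset.noncommProd_insert_of_notMem _ _ _ _ ha,
      Finset.noncommProd_insert_of_notMem _ _ _ _ ha, Finset.prod_insert ha]
    have hu' : (t : Set ι).Pairwise (Function.onFun Commute u) :=
      hu.mono (by simp)
    have h1 : Commute (t.noncommProd u hu') (f a) :=
      (Finset.noncommProd_commute _ _ _ _ fun x _ => (hc x a).symm).symm
    rw [mul_assoc, ← mul_assoc _ (f a), h1.eq, mul_assoc (f a), ih, ← mul_assoc, huf,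
      mul_smul_comm, smul_mul_assoc, smul_smul, mul_comm (c a)]

theorem Uop_mul_Pop (U : Δp → G → H →L[ℂ] H)
    (hU : ∀ σ σ' g g', Commute (U σ g) (U σ' g'))
    (hUhom : ∀ σ g g', U σ (g + g') = U σ g * U σ g')
    (φ : Δp → G) (k : Δp → PDual G) :
    Uop U hU φ * Pop U hU k = expA (pairing k φ) • Pop U hU k := by
  unfold Uop Pop commProd pairing
  rw [expA_sum]
  refine noncommProd_mul_eq_smul _ _ _ _ (fun σ => U_mul_Pfactor U hUhom k σ (φ σ)) ?_ _ _
  intro σ σ'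
  unfold Pfactor
  apply Commute.smul_right
  apply Commute.sum_right
  intro g _
  exact (hU _ _ _ _).smul_right _

theorem pairing_bd (s : Δp1 → Δp → ℤ) (φ : Δp → G) (hφ : cb s φ = 0) (l : Δp1 → PDual G) :
    pairing (bd s l) φ = 0 := by
  have h : pairing (bd s l) φ = ∑ τ, l τ (cb s φ τ) := by
    simp only [pairing, bd, cb, map_sum, map_zsmul, AddMonoidHom.finsetSum_apply,
      AddMonoidHom.zsmul_apply]
    exact Finset.sum_comm
  simp [h, hφ]

/-- **Irreducible sectors of the p-form symmetry**: for every cocycle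
`φ ∈ Z^p(G)` and every chain `k ∈ C_p(Ĝ)`, the operator
`Q_k = ∑_{k' : k' − k ∈ B_p(Ĝ)} P(k')` satisfies `U(φ) Q_k = e^{i⟨k,φ⟩} Q_k`. -/
theorem irreducible_sector_phase
    (s : Δp1 → Δp → ℤ)
    (U : Δp → G → H →L[ℂ] H)
    (hU : ∀ σ σ' g g', Commute (U σ g) (U σ' g'))
    (hUhom : ∀ σ g g', U σ (g + g') = U σ g * U σ g')
    (hU0 : ∀ σ, U σ 0 = 1)
    (hUunit : ∀ σ g, star (U σ g) * U σ g = 1 ∧ U σ g * star (U σ g) = 1)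
    (φ : Δp → G) (hφ : cb s φ = 0) (k : Δp → PDual G) :
    Uop U hU φ * (∑ᶠ k' ∈ {k' : Δp → PDual G | k' - k ∈ Set.range (bd (G := G) s)},
        Pop U hU k')
      = expA (pairing k φ) •
        (∑ᶠ k' ∈ {k' : Δp → PDual G | k' - k ∈ Set.range (bd (G := G) s)},
          Pop U hU k') := by
  have hfin : {k' : Δp → PDual G | k' - k ∈ Set.range (bd (G := G) s)}.Finite :=
    Set.toFinite _
  rw [finsum_mem_eq_finite_toFinset_sum _ hfin, Finset.mul_sum, Finset.smul_sum]
  refine Finset.sum_congr rfl fun k' hk' => ?_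
  rw [Set.Finite.mem_toFinset] at hk'
  obtain ⟨l, hl⟩ := hk'
  rw [Uop_mul_Pop U hU hUhom]
  have hp : pairing k' φ = pairing k φ := by
    have hk : k' = bd s l + k := by rw [hl]; abel
    have h0 := pairing_bd s φ hφ l
    rw [hk]
    simp only [pairing, Pi.add_apply, AddMonoidHom.add_apply, Finset.sum_add_distrib] at h0 ⊢
    rw [h0, zero_add]
  rw [hp]
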